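/- arXiv:2105.06310 — 14 statements merged into one kernel-verified Lean document; each statement's English description precedes it below -/
import Mathlib

section
/- Let T be a relative Rota-Baxter operator on a Hom-associative algebra (A,·,α) with respect to a representation (V, λˡ, λʳ, φ). Define a bilinear operation ⋄ on V by u⋄v := λˡ(T(u))v + λʳ(T(v))u. Then (V, ⋄, φ) is a Hom-associative algebra. -/
/-- `(A, mul, α)` is a Hom-associative algebra: `α` is multiplicative w.r.t. `mul` and
the Hom-associativity condition holds. -/
def IsHomAssociative {K A : Type*} [Field K] [AddCommGroup A] [Module K A]
    (mul : A →ₗ[K] A →ₗ[K] A) (α : A →ₗ[K] A) : Prop :=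
  (∀ x y : A, α (mul x y) = mul (α x) (α y)) ∧
  (∀ x y z : A, mul (mul x y) (α z) = mul (α x) (mul y z))

/-- `(V, ll, lr, φ)` is a representation of the Hom-associative algebra `(A, mul, α)`. -/
def IsAssocRep {K A V : Type*} [Field K] [AddCommGroup A] [Module K A]
    [AddCommGroup V] [Module K V]
    (mul : A →ₗ[K] A →ₗ[K] A) (α : A →ₗ[K] A)
    (ll lr : A →ₗ[K] V →ₗ[K] V) (φ : V →ₗ[K] V) : Prop :=
  (∀ (x : A) (v : V), φ (ll x v) = ll (α x) (φ v)) ∧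
  (∀ (x : A) (v : V), φ (lr x v) = lr (α x) (φ v)) ∧
  (∀ (x y : A) (v : V), ll (mul x y) (φ v) = ll (α x) (ll y v)) ∧
  (∀ (x y : A) (v : V), lr (mul x y) (φ v) = lr (α y) (lr x v)) ∧
  (∀ (x y : A) (v : V), ll (α x) (lr y v) = lr (α y) (ll x v))


/-- If `T` is a relative Rota-Baxter operator on a Hom-associative algebra `(A,·,α)` with
respect to a representation `(V, λˡ, λʳ, φ)`, then `u⋄v := λˡ(Tu)v + λʳ(Tv)u` makes
`(V, ⋄, φ)` a Hom-associative algebra. -/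
theorem homAssoc_of_relativeRotaBaxter
    {K A V : Type*} [Field K] [CharZero K]
    [AddCommGroup A] [Module K A] [AddCommGroup V] [Module K V]
    (mul : A →ₗ[K] A →ₗ[K] A) (α : A →ₗ[K] A)
    (hA : IsHomAssociative mul α)
    (ll lr : A →ₗ[K] V →ₗ[K] V) (φ : V →ₗ[K] V)
    (hrep : IsAssocRep mul α ll lr φ)
    (T : V →ₗ[K] A)
    (hTφ : ∀ v, T (φ v) = α (T v))
    (hT : ∀ u v, mul (T u) (T v) = T (ll (T u) v + lr (T v) u)) :
    IsHomAssociative (ll.comp T + (lr.comp T).flip) φ := by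
  obtain ⟨hl, hr, hll, hrr, hlr⟩ := hrep
  refine ⟨fun u v => ?_, fun u v w => ?_⟩
  · simp only [LinearMap.add_apply, LinearMap.comp_apply, LinearMap.flip_apply, map_add, hl, hr,
      hTφ]
  · simp only [LinearMap.add_apply, LinearMap.comp_apply, LinearMap.flip_apply]
    rw [← hT, ← hT, hTφ, hTφ, hll, hrr, map_add, map_add, hlr]
    abel
end

section
/- Let T be a relative Rota-Baxter operator on a Hom-associative algebra (A,·,α) with respect to a representation (V, λˡ, λʳ, φ), and equip V with the Hom-associative multiplication u⋄v := λˡ(T(u))v + λʳ(T(v))u. Define λ̄ˡ, λ̄ʳ: V → End(A) by λ̄ˡ(u)x := T(u)·x − T(λʳ(x)u) and λ̄ʳ(u)x := x·T(u) − T(λˡ(x)u). Then (A, λ̄ˡ, λ̄ʳ, α) is a representation of the Hom-associative algebra (V, ⋄, φ). -/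
/-- If `T` is a relative Rota-Baxter operator on a Hom-associative algebra `(A,·,α)` with
respect to a representation `(V, λˡ, λʳ, φ)`, then `(A, λ̄ˡ, λ̄ʳ, α)` with
`λ̄ˡ(u)x = T(u)·x − T(λʳ(x)u)` and `λ̄ʳ(u)x = x·T(u) − T(λˡ(x)u)` is a representation
of the Hom-associative algebra `(V, ⋄, φ)`, `u⋄v := λˡ(Tu)v + λʳ(Tv)u`. -/
theorem rep_of_relativeRotaBaxter_homAssoc
    {K A V : Type*} [Field K] [CharZero K]
    [AddCommGroup A] [Module K A] [AddCommGroup V] [Module K V]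
    (mul : A →ₗ[K] A →ₗ[K] A) (α : A →ₗ[K] A)
    (hA : IsHomAssociative mul α)
    (ll lr : A →ₗ[K] V →ₗ[K] V) (φ : V →ₗ[K] V)
    (hrep : IsAssocRep mul α ll lr φ)
    (T : V →ₗ[K] A)
    (hTφ : ∀ v, T (φ v) = α (T v))
    (hT : ∀ u v, mul (T u) (T v) = T (ll (T u) v + lr (T v) u)) :
    IsAssocRep (ll.comp T + (lr.comp T).flip) φ
      (mul.comp T - lr.flip.compr₂ T) (mul.flip.comp T - ll.flip.compr₂ T) α := by
  obtain ⟨hα, hassoc⟩ := hA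
  obtain ⟨hl, hr, hll, hrr, hlr⟩ := hrep
  have hTl : ∀ u w, mul (α (T u)) (T w) = T (ll (α (T u)) w) + T (lr (T w) (φ u)) := by
    intro u w
    rw [← hTφ, hT, map_add]
  have hTr : ∀ u w, mul (T w) (α (T u)) = T (ll (T w) (φ u)) + T (lr (α (T u)) w) := by
    intro u w
    rw [← hTφ, hT, map_add]
  refine ⟨fun u x => ?_, fun u x => ?_, fun u v x => ?_, fun u v x => ?_, fun u v x => ?_⟩ <;>
    simp only [LinearMap.sub_apply, LinearMap.add_apply, LinearMap.comp_apply,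
      LinearMap.flip_apply, LinearMap.compr₂_apply, map_sub, map_add, hTφ]
  · rw [hα, ← hTφ (lr x u), hr]
  · rw [hα, ← hTφ (ll x u), hl]
  · rw [sub_add_sub_comm, ← LinearMap.add_apply, ← map_add mul, ← map_add T, ← hT, hassoc, hTl, hrr, hlr]
    abel
  · rw [sub_add_sub_comm, ← map_add (mul (α x)), ← map_add T, ← hT, ← hassoc, hTr, hll, ← hlr]
    abel
  · rw [hTl, hTr, hassoc, hrr, hll]
    abel
end

section
/- Let (A,[,],α) be a Hom-Leibniz algebra, V a vector space, φ: V → V linear, and ρˡ, ρʳ: A → End(V) linear maps. On the direct sum A ⊕ V define {(x,u),(y,v)} := ([x,y], ρˡ(x)v + ρʳ(y)u) and (α⊕φ)(x,u) := (α(x), φ(u)). Then (V, ρˡ, ρʳ, φ) is a representation of (A,[,],α) if and only if (A ⊕ V, {,}, α⊕φ) is a Hom-Leibniz algebra. -/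
/-- `(A, br, α)` is a (right) Hom-Leibniz algebra. -/
def IsHomLeibniz {K A : Type*} [Field K] [AddCommGroup A] [Module K A]
    (br : A →ₗ[K] A →ₗ[K] A) (α : A →ₗ[K] A) : Prop :=
  (∀ x y : A, α (br x y) = br (α x) (α y)) ∧
  (∀ x y z : A, br (br x y) (α z) = br (α x) (br y z) + br (br x z) (α y))

/-- `(V, rl, rr, φ)` is a representation of the Hom-Leibniz algebra `(A, br, α)`. -/
def IsLeibRep {K A V : Type*} [Field K] [AddCommGroup A] [Module K A]
    [AddCommGroup V] [Module K V]
    (br : A →ₗ[K] A →ₗ[K] A) (α : A →ₗ[K] A)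
    (rl rr : A →ₗ[K] V →ₗ[K] V) (φ : V →ₗ[K] V) : Prop :=
  (∀ (x : A) (v : V), φ (rl x v) = rl (α x) (φ v)) ∧
  (∀ (x : A) (v : V), φ (rr x v) = rr (α x) (φ v)) ∧
  (∀ (x y : A) (v : V), rl (br x y) (φ v) = rl (α x) (rl y v) + rr (α y) (rl x v)) ∧
  (∀ (x y : A) (v : V), rr (α y) (rl x v) = rl (α x) (rr y v) + rl (br x y) (φ v)) ∧
  (∀ (x y : A) (v : V), rr (α y) (rr x v) = rr (br x y) (φ v) + rr (α x) (rr y v))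


/-- `(V, ρˡ, ρʳ, φ)` is a representation of the Hom-Leibniz algebra `(A,[,],α)` iff the
semidirect-product bracket `{(x,u),(y,v)} = ([x,y], ρˡ(x)v + ρʳ(y)u)` together with
`α⊕φ` makes `A ⊕ V` a Hom-Leibniz algebra. -/
theorem leibRep_iff_semidirect_homLeibniz
    {K A V : Type*} [Field K] [CharZero K]
    [AddCommGroup A] [Module K A] [AddCommGroup V] [Module K V]
    (br : A →ₗ[K] A →ₗ[K] A) (α : A →ₗ[K] A)
    (hA : IsHomLeibniz br α)
    (rl rr : A →ₗ[K] V →ₗ[K] V) (φ : V →ₗ[K] V)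
    (Br : (A × V) →ₗ[K] (A × V) →ₗ[K] (A × V))
    (hBr : ∀ p q : A × V, Br p q = (br p.1 q.1, rl p.1 q.2 + rr q.1 p.2)) :
    IsLeibRep br α rl rr φ ↔ IsHomLeibniz Br (α.prodMap φ) := by
  obtain ⟨hA₁, hA₂⟩ := hA
  constructor
  · rintro ⟨h₁, h₂, h₃, h₄, h₅⟩
    refine ⟨?_, ?_⟩
    · rintro ⟨x, u⟩ ⟨y, v⟩
      simp [hBr, hA₁, h₁, h₂]
    · rintro ⟨x, u⟩ ⟨y, v⟩ ⟨z, w⟩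
      simp only [hBr, LinearMap.prodMap_apply, Prod.mk_add_mk, Prod.mk.injEq, map_add]
      refine ⟨hA₂ x y z, ?_⟩
      rw [h₃, h₄ x z v, h₅ y z u]
      abel
  · rintro ⟨hm, hl⟩
    refine ⟨fun x v => ?_, fun x v => ?_, fun x y v => ?_, fun x y v => ?_, fun x y v => ?_⟩
    · simpa [hBr] using congrArg Prod.snd (hm (x, 0) (0, v))
    · simpa [hBr] using congrArg Prod.snd (hm (0, v) (x, 0))
    · simpa [hBr] using congrArg Prod.snd (hl (x, 0) (y, 0) (0, v))
    · simpa [hBr] using congrArg Prod.snd (hl (x, 0) (0, v) (y, 0))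
    · simpa [hBr] using congrArg Prod.snd (hl (0, v) (x, 0) (y, 0))
end

section
/- Let ((A₁, ρ₂ˡ, ρ₂ʳ, α₁), (A₂, ρ₁ˡ, ρ₁ʳ, α₂)) be a matched pair of Hom-Leibniz algebras (A₁,[,]₁,α₁) and (A₂,[,]₂,α₂). Then A₁ ⊕ A₂ is a Hom-Leibniz algebra with bracket {(x,u),(y,v)} := ([x,y]₁ + ρ₂ˡ(u)y + ρ₂ʳ(v)x, [u,v]₂ + ρ₁ˡ(x)v + ρ₁ʳ(y)u) and structure map (α₁⊕α₂)(x,u) := (α₁(x), α₂(u)). -/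
/-- The direct sum of a matched pair of Hom-Leibniz algebras is a Hom-Leibniz algebra. -/
theorem matchedPair_homLeibniz
    {K A₁ A₂ : Type*} [Field K] [CharZero K]
    [AddCommGroup A₁] [Module K A₁] [AddCommGroup A₂] [Module K A₂]
    (br₁ : A₁ →ₗ[K] A₁ →ₗ[K] A₁) (α₁ : A₁ →ₗ[K] A₁)
    (br₂ : A₂ →ₗ[K] A₂ →ₗ[K] A₂) (α₂ : A₂ →ₗ[K] A₂)
    (h₁ : IsHomLeibniz br₁ α₁) (h₂ : IsHomLeibniz br₂ α₂)
    (r1l r1r : A₁ →ₗ[K] A₂ →ₗ[K] A₂) (r2l r2r : A₂ →ₗ[K] A₁ →ₗ[K] A₁)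
    (hrep₁ : IsLeibRep br₁ α₁ r1l r1r α₂)
    (hrep₂ : IsLeibRep br₂ α₂ r2l r2r α₁)
    (mp1 : ∀ (x : A₁) (u v : A₂),
      r1r (α₁ x) (br₂ u v) - br₂ (α₂ u) (r1r x v) - br₂ (r1r x u) (α₂ v)
        - r1r (r2l v x) (α₂ u) - r1l (r2l u x) (α₂ v) = 0)
    (mp2 : ∀ (x : A₁) (u v : A₂),
      r1l (α₁ x) (br₂ u v) - br₂ (r1l x u) (α₂ v) + br₂ (r1l x v) (α₂ u)
        - r1l (r2r u x) (α₂ v) + r1l (r2r v x) (α₂ u) = 0)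
    (mp3 : ∀ (x : A₁) (u v : A₂),
      r1r (α₁ x) (br₂ u v) - br₂ (r1r x u) (α₂ v) + br₂ (α₂ u) (r1l x v)
        - r1l (r2l u x) (α₂ v) + r1r (r2r v x) (α₂ u) = 0)
    (mp4 : ∀ (x y : A₁) (u : A₂),
      r2r (α₂ u) (br₁ x y) - br₁ (α₁ x) (r2r u y) - br₁ (r2r u x) (α₁ y)
        - r2r (r1l y u) (α₁ x) - r2l (r1l x u) (α₁ y) = 0)
    (mp5 : ∀ (x y : A₁) (u : A₂),
      r2l (α₂ u) (br₁ x y) - br₁ (r2l u x) (α₁ y) + br₁ (r2l u y) (α₁ x)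
        - r2l (r1r x u) (α₁ y) + r2l (r1r y u) (α₁ x) = 0)
    (mp6 : ∀ (x y : A₁) (u : A₂),
      r2r (α₂ u) (br₁ x y) - br₁ (r2r u x) (α₁ y) + br₁ (α₁ x) (r2l u y)
        - r2l (r1l x u) (α₁ y) + r2r (r1r y u) (α₁ x) = 0)
    (Br : (A₁ × A₂) →ₗ[K] (A₁ × A₂) →ₗ[K] (A₁ × A₂))
    (hBr : ∀ p q : A₁ × A₂,
      Br p q = (br₁ p.1 q.1 + r2l p.2 q.1 + r2r q.2 p.1,
                br₂ p.2 q.2 + r1l p.1 q.2 + r1r q.1 p.2)) :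
    IsHomLeibniz Br (α₁.prodMap α₂) := by
  obtain ⟨m₁, j₁⟩ := h₁
  obtain ⟨m₂, j₂⟩ := h₂
  obtain ⟨el₁, er₁, a₁, b₁, c₁⟩ := hrep₁
  obtain ⟨el₂, er₂, a₂, b₂, c₂⟩ := hrep₂
  refine ⟨?_, ?_⟩
  · rintro ⟨x, u⟩ ⟨y, v⟩
    simp only [hBr, LinearMap.prodMap_apply, map_add, m₁, m₂, el₁, er₁, el₂, er₂]
  · rintro ⟨x, u⟩ ⟨y, v⟩ ⟨z, w⟩
    simp only [hBr, LinearMap.prodMap_apply, map_add, LinearMap.add_apply, Prod.mk_add_mk,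
      Prod.mk.injEq]
    constructor
    · linear_combination (norm := module) j₁ x y z + a₂ u v z + b₂ u w y + c₂ v w x
        + mp4 x y w - mp6 x z v - mp5 y z u
    · linear_combination (norm := module) j₂ u v w + a₁ x y w + b₁ x z v + c₁ y z u
        + mp1 z u v - mp3 y u w - mp2 x v w
end

section
/- Let T be a relative Rota-Baxter operator on a Hom-Leibniz algebra (A,[,],α) with respect to a representation (V, ρˡ, ρʳ, φ). Define a bilinear bracket on V by [u,v]_T := ρˡ(T(u))v + ρʳ(T(v))u. Then (V, [,]_T, φ) is a Hom-Leibniz algebra. -/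
/-- If `T` is a relative Rota-Baxter operator on a Hom-Leibniz algebra `(A,[,],α)` with
respect to a representation `(V, ρˡ, ρʳ, φ)`, then `[u,v]_T := ρˡ(Tu)v + ρʳ(Tv)u` makes
`(V, [,]_T, φ)` a Hom-Leibniz algebra. -/
theorem homLeibniz_of_relativeRotaBaxter
    {K A V : Type*} [Field K] [CharZero K]
    [AddCommGroup A] [Module K A] [AddCommGroup V] [Module K V]
    (br : A →ₗ[K] A →ₗ[K] A) (α : A →ₗ[K] A)
    (hA : IsHomLeibniz br α)
    (rl rr : A →ₗ[K] V →ₗ[K] V) (φ : V →ₗ[K] V)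
    (hrep : IsLeibRep br α rl rr φ)
    (T : V →ₗ[K] A)
    (hTφ : ∀ v, T (φ v) = α (T v))
    (hT : ∀ u v, br (T u) (T v) = T (rl (T u) v + rr (T v) u)) :
    IsHomLeibniz (rl.comp T + (rr.comp T).flip) φ := by
  obtain ⟨hl, hr, hll, hrl, hrr⟩ := hrep
  refine ⟨fun u v => ?_, fun u v w => ?_⟩
  · simp only [LinearMap.add_apply, LinearMap.comp_apply, LinearMap.flip_apply, map_add,
      hl, hr, hTφ]
  · simp only [LinearMap.add_apply, LinearMap.comp_apply, LinearMap.flip_apply, ← hT, hTφ]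
    rw [hll (T u) (T v) w, map_add, hrl (T u) (T w) v, hrr (T v) (T w) u, map_add, map_add]
    abel
end

section
/- Let T be a relative Rota-Baxter operator on a Hom-Leibniz algebra (A,[,],α) with respect to a representation (V, ρˡ, ρʳ, φ), and equip V with the Hom-Leibniz bracket [u,v]_T := ρˡ(T(u))v + ρʳ(T(v))u. Define ρ̄ˡ, ρ̄ʳ: V → End(A) by ρ̄ˡ(u)x := [T(u),x] − T(ρʳ(x)u) and ρ̄ʳ(u)x := [x,T(u)] − T(ρˡ(x)u). Then (A, ρ̄ˡ, ρ̄ʳ, α) is a representation of the Hom-Leibniz algebra (V, [,]_T, φ). -/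
/-- If `T` is a relative Rota-Baxter operator on a Hom-Leibniz algebra `(A,[,],α)` with
respect to a representation `(V, ρˡ, ρʳ, φ)`, then `(A, ρ̄ˡ, ρ̄ʳ, α)` with
`ρ̄ˡ(u)x = [Tu,x] − T(ρʳ(x)u)` and `ρ̄ʳ(u)x = [x,Tu] − T(ρˡ(x)u)` is a representation of
the Hom-Leibniz algebra `(V, [,]_T, φ)`, `[u,v]_T := ρˡ(Tu)v + ρʳ(Tv)u`. -/
theorem rep_of_relativeRotaBaxter_homLeibniz
    {K A V : Type*} [Field K] [CharZero K]
    [AddCommGroup A] [Module K A] [AddCommGroup V] [Module K V]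
    (br : A →ₗ[K] A →ₗ[K] A) (α : A →ₗ[K] A)
    (hA : IsHomLeibniz br α)
    (rl rr : A →ₗ[K] V →ₗ[K] V) (φ : V →ₗ[K] V)
    (hrep : IsLeibRep br α rl rr φ)
    (T : V →ₗ[K] A)
    (hTφ : ∀ v, T (φ v) = α (T v))
    (hT : ∀ u v, br (T u) (T v) = T (rl (T u) v + rr (T v) u)) :
    IsLeibRep (rl.comp T + (rr.comp T).flip) φ
      (br.comp T - rr.flip.compr₂ T) (br.flip.comp T - rl.flip.compr₂ T) α := by
  obtain ⟨hα, hLeib⟩ := hA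
  obtain ⟨hφl, hφr, hl, hrl, hrr⟩ := hrep
  refine ⟨?_, ?_, ?_, ?_, ?_⟩
  · intro u x
    simp [hα, hφr, ← hTφ]
  · intro u x
    simp [hα, hφl, ← hTφ]
  · intro u v x
    have h := hLeib (T u) (T v) x
    have h₁ := congrArg T (hrl (T u) x v)
    have h₂ := congrArg T (hrr (T v) x u)
    simp only [LinearMap.add_apply, LinearMap.sub_apply, LinearMap.comp_apply,
      LinearMap.flip_apply, LinearMap.compr₂_apply, map_add, map_sub, ← hTφ, hT] at h h₁ h₂ ⊢
    linear_combination (norm := module) h - h₁ - h₂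
  · intro u v x
    have h := hLeib (T u) x (T v)
    have h₁ := congrArg T (hl (T u) x v)
    have h₂ := congrArg T (hrr x (T v) u)
    simp only [LinearMap.add_apply, LinearMap.sub_apply, LinearMap.comp_apply,
      LinearMap.flip_apply, LinearMap.compr₂_apply, map_add, map_sub, ← hTφ, hT] at h h₁ h₂ ⊢
    linear_combination (norm := module) h - h₁ - h₂
  · intro u v x
    have h := hLeib x (T u) (T v)
    have h₁ := congrArg T (hl x (T u) v)
    have h₂ := congrArg T (hrl x (T v) u)
    simp only [LinearMap.add_apply, LinearMap.sub_apply, LinearMap.comp_apply,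
      LinearMap.flip_apply, LinearMap.compr₂_apply, map_add, map_sub, ← hTφ, hT] at h h₁ h₂ ⊢
    linear_combination (norm := module) h - h₁ - h₂
end

section
/- Let f: (A₁,·₁,[,]₁,α₁) → (A₂,·₂,[,]₂,α₂) be a morphism of Hom-Leibniz Poisson algebras. Define λˡ, λʳ, ρˡ, ρʳ: A₁ → End(A₂) by λˡ(a)b := f(a)·₂b, λʳ(a)b := b·₂f(a), ρˡ(a)b := [f(a),b]₂, ρʳ(a)b := [b,f(a)]₂ for a ∈ A₁, b ∈ A₂. Then (A₂, λˡ, λʳ, ρˡ, ρʳ, α₂) is a representation of the Hom-Leibniz Poisson algebra (A₁,·₁,[,]₁,α₁). -/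
/-- `(A, mul, br, α)` is a Hom-Leibniz Poisson algebra. -/
def IsHomLeibnizPoisson {K A : Type*} [Field K] [AddCommGroup A] [Module K A]
    (mul br : A →ₗ[K] A →ₗ[K] A) (α : A →ₗ[K] A) : Prop :=
  IsHomAssociative mul α ∧ IsHomLeibniz br α ∧
  (∀ x y z : A, br (mul x y) (α z) = mul (α x) (br y z) + mul (br x z) (α y))

/-- `(V, ll, lr, rl, rr, φ)` is a representation of the Hom-Leibniz Poisson algebra
`(A, mul, br, α)`. -/
def IsLPRep {K A V : Type*} [Field K] [AddCommGroup A] [Module K A]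
    [AddCommGroup V] [Module K V]
    (mul br : A →ₗ[K] A →ₗ[K] A) (α : A →ₗ[K] A)
    (ll lr rl rr : A →ₗ[K] V →ₗ[K] V) (φ : V →ₗ[K] V) : Prop :=
  IsAssocRep mul α ll lr φ ∧ IsLeibRep br α rl rr φ ∧
  (∀ (x y : A) (v : V), rr (α y) (ll x v) = ll (α x) (rr y v) + ll (br x y) (φ v)) ∧
  (∀ (x y : A) (v : V), rr (α y) (lr x v) = lr (br x y) (φ v) + lr (α x) (rr y v)) ∧
  (∀ (x y : A) (v : V), rl (mul x y) (φ v) = ll (α x) (rl y v) + lr (α y) (rl x v))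


/-- If `f : (A₁,·₁,[,]₁,α₁) → (A₂,·₂,[,]₂,α₂)` is a morphism of Hom-Leibniz Poisson
algebras, then `(A₂, λˡ, λʳ, ρˡ, ρʳ, α₂)` with `λˡ(a)b = f(a)·₂b`, `λʳ(a)b = b·₂f(a)`,
`ρˡ(a)b = [f(a),b]₂`, `ρʳ(a)b = [b,f(a)]₂` is a representation of `(A₁,·₁,[,]₁,α₁)`. -/
theorem rep_of_homLeibnizPoisson_morphism
    {K A₁ A₂ : Type*} [Field K] [CharZero K]
    [AddCommGroup A₁] [Module K A₁] [AddCommGroup A₂] [Module K A₂]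
    (mul₁ br₁ : A₁ →ₗ[K] A₁ →ₗ[K] A₁) (α₁ : A₁ →ₗ[K] A₁)
    (mul₂ br₂ : A₂ →ₗ[K] A₂ →ₗ[K] A₂) (α₂ : A₂ →ₗ[K] A₂)
    (h₁ : IsHomLeibnizPoisson mul₁ br₁ α₁) (h₂ : IsHomLeibnizPoisson mul₂ br₂ α₂)
    (f : A₁ →ₗ[K] A₂)
    (hfα : ∀ x, f (α₁ x) = α₂ (f x))
    (hfm : ∀ x y, f (mul₁ x y) = mul₂ (f x) (f y))
    (hfb : ∀ x y, f (br₁ x y) = br₂ (f x) (f y)) :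
    IsLPRep mul₁ br₁ α₁ (mul₂.comp f) (mul₂.flip.comp f)
      (br₂.comp f) (br₂.flip.comp f) α₂ := by
  obtain ⟨⟨hαm, hassoc⟩, ⟨hαb, hleib⟩, hpois⟩ := h₂
  simp only [IsLPRep, IsAssocRep, IsLeibRep, LinearMap.comp_apply, LinearMap.flip_apply,
    hfα, hfm, hfb]
  exact ⟨⟨fun x v => hαm (f x) v, fun x v => hαm v (f x), fun x y v => hassoc (f x) (f y) v,
      fun x y v => (hassoc v (f x) (f y)).symm, fun x y v => (hassoc (f x) v (f y)).symm⟩,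
    ⟨fun x v => hαb (f x) v, fun x v => hαb v (f x), fun x y v => hleib (f x) (f y) v,
      fun x y v => hleib (f x) v (f y), fun x y v => hleib v (f x) (f y)⟩,
    fun x y v => hpois (f x) v (f y), fun x y v => hpois v (f x) (f y),
    fun x y v => hpois (f x) (f y) v⟩
end

section
/- Let (V, λˡ, λʳ, ρˡ, ρʳ, φ) be a representation of a Hom-Leibniz Poisson algebra (A,·,[,],α) and let β: A → A be a morphism of Hom-Leibniz Poisson algebras from (A,·,[,],α) to itself. Then (V, λˡ∘β, λʳ∘β, ρˡ∘β, ρʳ∘β, φ) is again a representation of (A,·,[,],α). -/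
/-- If `(V, λˡ, λʳ, ρˡ, ρʳ, φ)` is a representation of the Hom-Leibniz Poisson algebra
`(A,·,[,],α)` and `β` is a self-morphism, then `(V, λˡ∘β, λʳ∘β, ρˡ∘β, ρʳ∘β, φ)` is again
a representation. -/
theorem rep_comp_self_morphism_homLeibnizPoisson
    {K A V : Type*} [Field K] [CharZero K]
    [AddCommGroup A] [Module K A] [AddCommGroup V] [Module K V]
    (mul br : A →ₗ[K] A →ₗ[K] A) (α : A →ₗ[K] A)
    (hA : IsHomLeibnizPoisson mul br α)
    (ll lr rl rr : A →ₗ[K] V →ₗ[K] V) (φ : V →ₗ[K] V)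
    (hrep : IsLPRep mul br α ll lr rl rr φ)
    (β : A →ₗ[K] A)
    (hβα : ∀ x, β (α x) = α (β x))
    (hβm : ∀ x y, β (mul x y) = mul (β x) (β y))
    (hβb : ∀ x y, β (br x y) = br (β x) (β y)) :
    IsLPRep mul br α (ll.comp β) (lr.comp β) (rl.comp β) (rr.comp β) φ := by
  obtain ⟨⟨a₁, a₂, a₃, a₄, a₅⟩, ⟨l₁, l₂, l₃, l₄, l₅⟩, c₁, c₂, c₃⟩ := hrep
  simp only [IsLPRep, IsAssocRep, IsLeibRep, LinearMap.comp_apply, hβα, hβm, hβb]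
  exact ⟨⟨fun x => a₁ (β x), fun x => a₂ (β x), fun x y => a₃ (β x) (β y),
      fun x y => a₄ (β x) (β y), fun x y => a₅ (β x) (β y)⟩,
    ⟨fun x => l₁ (β x), fun x => l₂ (β x), fun x y => l₃ (β x) (β y),
      fun x y => l₄ (β x) (β y), fun x y => l₅ (β x) (β y)⟩,
    fun x y => c₁ (β x) (β y), fun x y => c₂ (β x) (β y), fun x y => c₃ (β x) (β y)⟩
end

section
/- Let (A,·,[,],α) be a Hom-Leibniz Poisson algebra, V a vector space, φ: V → V linear, and λˡ, λʳ, ρˡ, ρʳ: A → End(V) linear maps. On the direct sum A ⊕ V define (x,u)∗(y,v) := (x·y, λˡ(x)v + λʳ(y)u), {(x,u),(y,v)} := ([x,y], ρˡ(x)v + ρʳ(y)u), and (α⊕φ)(x,u) := (α(x), φ(u)). Then (V, λˡ, λʳ, ρˡ, ρʳ, φ) is a representation of (A,·,[,],α) if and only if (A ⊕ V, ∗, {,}, α⊕φ) is a Hom-Leibniz Poisson algebra. -/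
theorem isAssocRep_iff_isHomAssociative_semidirect
    {K A V : Type*} [Field K]
    [AddCommGroup A] [Module K A] [AddCommGroup V] [Module K V]
    {mul : A →ₗ[K] A →ₗ[K] A} {α : A →ₗ[K] A} (hA : IsHomAssociative mul α)
    {ll lr : A →ₗ[K] V →ₗ[K] V} {φ : V →ₗ[K] V}
    {Mul : (A × V) →ₗ[K] (A × V) →ₗ[K] (A × V)}
    (hMul : ∀ p q : A × V, Mul p q = (mul p.1 q.1, ll p.1 q.2 + lr q.1 p.2)) :
    IsAssocRep mul α ll lr φ ↔ IsHomAssociative Mul (α.prodMap φ) := by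
  obtain ⟨hα, hassoc⟩ := hA
  simp only [IsAssocRep, IsHomAssociative, hMul, LinearMap.prodMap_apply, Prod.forall,
    Prod.mk.injEq, map_add, hα, hassoc, true_and]
  constructor
  · rintro ⟨h₁, h₂, h₃, h₄, h₅⟩
    refine ⟨fun x u y v => by rw [h₁, h₂], fun x u y v z w => ?_⟩
    rw [h₃, h₄, h₅]
    abel
  · rintro ⟨h, h'⟩
    refine ⟨fun x v => ?_, fun x v => ?_, fun x y v => ?_, fun x y v => ?_, fun x y v => ?_⟩
    · simpa using h x 0 0 v
    · simpa using h 0 v x 0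
    · simpa using h' x 0 y 0 0 v
    · simpa using (h' 0 v x 0 y 0).symm
    · simpa using (h' x 0 0 v y 0).symm

theorem isLeibRep_iff_isHomLeibniz_semidirect
    {K A V : Type*} [Field K]
    [AddCommGroup A] [Module K A] [AddCommGroup V] [Module K V]
    {br : A →ₗ[K] A →ₗ[K] A} {α : A →ₗ[K] A} (hA : IsHomLeibniz br α)
    {rl rr : A →ₗ[K] V →ₗ[K] V} {φ : V →ₗ[K] V}
    {Br : (A × V) →ₗ[K] (A × V) →ₗ[K] (A × V)}
    (hBr : ∀ p q : A × V, Br p q = (br p.1 q.1, rl p.1 q.2 + rr q.1 p.2)) :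
    IsLeibRep br α rl rr φ ↔ IsHomLeibniz Br (α.prodMap φ) := by
  obtain ⟨hα, hleib⟩ := hA
  simp only [IsLeibRep, IsHomLeibniz, hBr, LinearMap.prodMap_apply, Prod.forall,
    Prod.mk_add_mk, Prod.mk.injEq, map_add, hα, true_and]
  constructor
  · rintro ⟨h₁, h₂, h₃, h₄, h₅⟩
    refine ⟨fun x u y v => by rw [h₁, h₂], fun x u y v z w => ⟨hleib x y z, ?_⟩⟩
    rw [h₃ x y w, h₄ x z v, h₅ y z u]
    abel
  · rintro ⟨h, h'⟩
    refine ⟨fun x v => ?_, fun x v => ?_, fun x y v => ?_, fun x y v => ?_, fun x y v => ?_⟩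
    · simpa using h x 0 0 v
    · simpa using h 0 v x 0
    · simpa using (h' x 0 y 0 0 v).2
    · simpa using (h' x 0 0 v y 0).2
    · simpa using (h' 0 v x 0 y 0).2

theorem lpRep_compat_iff_poisson_semidirect
    {K A V : Type*} [Field K]
    [AddCommGroup A] [Module K A] [AddCommGroup V] [Module K V]
    {mul br : A →ₗ[K] A →ₗ[K] A} {α : A →ₗ[K] A}
    (hA : ∀ x y z : A, br (mul x y) (α z) = mul (α x) (br y z) + mul (br x z) (α y))
    {ll lr rl rr : A →ₗ[K] V →ₗ[K] V} {φ : V →ₗ[K] V}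
    {Mul Br : (A × V) →ₗ[K] (A × V) →ₗ[K] (A × V)}
    (hMul : ∀ p q : A × V, Mul p q = (mul p.1 q.1, ll p.1 q.2 + lr q.1 p.2))
    (hBr : ∀ p q : A × V, Br p q = (br p.1 q.1, rl p.1 q.2 + rr q.1 p.2)) :
    ((∀ (x y : A) (v : V), rr (α y) (ll x v) = ll (α x) (rr y v) + ll (br x y) (φ v)) ∧
      (∀ (x y : A) (v : V), rr (α y) (lr x v) = lr (br x y) (φ v) + lr (α x) (rr y v)) ∧
      (∀ (x y : A) (v : V), rl (mul x y) (φ v) = ll (α x) (rl y v) + lr (α y) (rl x v))) ↔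
    ∀ p q r : A × V, Br (Mul p q) (α.prodMap φ r) =
      Mul (α.prodMap φ p) (Br q r) + Mul (Br p r) (α.prodMap φ q) := by
  simp only [hMul, hBr, LinearMap.prodMap_apply, Prod.forall,
    Prod.mk_add_mk, Prod.mk.injEq, map_add, hA, true_and]
  constructor
  · rintro ⟨h₁, h₂, h₃⟩ x u y v z w
    rw [h₁ x z v, h₂ y z u, h₃ x y w]
    abel
  · intro h
    refine ⟨fun x y v => ?_, fun x y v => ?_, fun x y v => ?_⟩
    · simpa using h x 0 0 v y 0
    · simpa using h 0 v x 0 y 0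
    · simpa using h x 0 y 0 0 v


/-- `(V, λˡ, λʳ, ρˡ, ρʳ, φ)` is a representation of a Hom-Leibniz Poisson algebra
`(A,·,[,],α)` iff the semidirect-product operations on `A ⊕ V` make it a Hom-Leibniz
Poisson algebra. -/
theorem lpRep_iff_semidirect_homLeibnizPoisson
    {K A V : Type*} [Field K] [CharZero K]
    [AddCommGroup A] [Module K A] [AddCommGroup V] [Module K V]
    (mul br : A →ₗ[K] A →ₗ[K] A) (α : A →ₗ[K] A)
    (hA : IsHomLeibnizPoisson mul br α)
    (ll lr rl rr : A →ₗ[K] V →ₗ[K] V) (φ : V →ₗ[K] V)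
    (Mul Br : (A × V) →ₗ[K] (A × V) →ₗ[K] (A × V))
    (hMul : ∀ p q : A × V, Mul p q = (mul p.1 q.1, ll p.1 q.2 + lr q.1 p.2))
    (hBr : ∀ p q : A × V, Br p q = (br p.1 q.1, rl p.1 q.2 + rr q.1 p.2)) :
    IsLPRep mul br α ll lr rl rr φ ↔ IsHomLeibnizPoisson Mul Br (α.prodMap φ) := by
  obtain ⟨hassoc, hleib, hpoisson⟩ := hA
  exact and_congr (isAssocRep_iff_isHomAssociative_semidirect hassoc hMul)
    (and_congr (isLeibRep_iff_isHomLeibniz_semidirect hleib hBr)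
      (lpRep_compat_iff_poisson_semidirect hpoisson hMul hBr))
end

section
/- Let ((A₁, λ₂ˡ, λ₂ʳ, ρ₂ˡ, ρ₂ʳ, α₁), (A₂, λ₁ˡ, λ₁ʳ, ρ₁ˡ, ρ₁ʳ, α₂)) be a matched pair of Hom-Leibniz Poisson algebras (A₁,·,[,]₁,α₁) and (A₂,•,[,]₂,α₂). Then A₁ ⊕ A₂ is a Hom-Leibniz Poisson algebra with operations (x,u)∗(y,v) := (x·y + λ₂ˡ(u)y + λ₂ʳ(v)x, u•v + λ₁ˡ(x)v + λ₁ʳ(y)u), {(x,u),(y,v)} := ([x,y]₁ + ρ₂ˡ(u)y + ρ₂ʳ(v)x, [u,v]₂ + ρ₁ˡ(x)v + ρ₁ʳ(y)u), and structure map (α₁⊕α₂)(x,u) := (α₁(x), α₂(u)). -/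
/-- The direct sum of a matched pair of Hom-Leibniz Poisson algebras is a Hom-Leibniz
Poisson algebra. -/
theorem matchedPair_homLeibnizPoisson
    {K A₁ A₂ : Type*} [Field K] [CharZero K]
    [AddCommGroup A₁] [Module K A₁] [AddCommGroup A₂] [Module K A₂]
    (mul₁ br₁ : A₁ →ₗ[K] A₁ →ₗ[K] A₁) (α₁ : A₁ →ₗ[K] A₁)
    (mul₂ br₂ : A₂ →ₗ[K] A₂ →ₗ[K] A₂) (α₂ : A₂ →ₗ[K] A₂)
    (h₁ : IsHomLeibnizPoisson mul₁ br₁ α₁) (h₂ : IsHomLeibnizPoisson mul₂ br₂ α₂)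
    (l1l l1r r1l r1r : A₁ →ₗ[K] A₂ →ₗ[K] A₂)
    (l2l l2r r2l r2r : A₂ →ₗ[K] A₁ →ₗ[K] A₁)
    (hrep₁ : IsLPRep mul₁ br₁ α₁ l1l l1r r1l r1r α₂)
    (hrep₂ : IsLPRep mul₂ br₂ α₂ l2l l2r r2l r2r α₁)
    -- matched-pair conditions for the Hom-associative structures
    (ma1 : ∀ (x : A₁) (u v : A₂),
      l1l (α₁ x) (mul₂ u v) = l1l (l2r u x) (α₂ v) + mul₂ (l1l x u) (α₂ v))
    (ma2 : ∀ (x : A₁) (u v : A₂),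
      l1r (α₁ x) (mul₂ u v) = l1r (l2l v x) (α₂ u) + mul₂ (α₂ u) (l1r x v))
    (ma3 : ∀ (x y : A₁) (u : A₂),
      l2l (α₂ u) (mul₁ x y) = l2l (l1r x u) (α₁ y) + mul₁ (l2l u x) (α₁ y))
    (ma4 : ∀ (x y : A₁) (u : A₂),
      l2r (α₂ u) (mul₁ x y) = l2r (l1l y u) (α₁ x) + mul₁ (α₁ x) (l2r u y))
    (ma5 : ∀ (x : A₁) (u v : A₂),
      l1l (l2l u x) (α₂ v) + mul₂ (l1r x u) (α₂ v) - l1r (l2r v x) (α₂ u)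
        - mul₂ (α₂ u) (l1l x v) = 0)
    (ma6 : ∀ (x y : A₁) (u : A₂),
      l2l (l1l x u) (α₁ y) + mul₁ (l2r u x) (α₁ y) - l2r (l1r y u) (α₁ x)
        - mul₁ (α₁ x) (l2l u y) = 0)
    -- matched-pair conditions for the Hom-Leibniz structures
    (mp1 : ∀ (x : A₁) (u v : A₂),
      r1r (α₁ x) (br₂ u v) - br₂ (α₂ u) (r1r x v) - br₂ (r1r x u) (α₂ v)
        - r1r (r2l v x) (α₂ u) - r1l (r2l u x) (α₂ v) = 0)
    (mp2 : ∀ (x : A₁) (u v : A₂),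
      r1l (α₁ x) (br₂ u v) - br₂ (r1l x u) (α₂ v) + br₂ (r1l x v) (α₂ u)
        - r1l (r2r u x) (α₂ v) + r1l (r2r v x) (α₂ u) = 0)
    (mp3 : ∀ (x : A₁) (u v : A₂),
      r1r (α₁ x) (br₂ u v) - br₂ (r1r x u) (α₂ v) + br₂ (α₂ u) (r1l x v)
        - r1l (r2l u x) (α₂ v) + r1r (r2r v x) (α₂ u) = 0)
    (mp4 : ∀ (x y : A₁) (u : A₂),
      r2r (α₂ u) (br₁ x y) - br₁ (α₁ x) (r2r u y) - br₁ (r2r u x) (α₁ y)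
        - r2r (r1l y u) (α₁ x) - r2l (r1l x u) (α₁ y) = 0)
    (mp5 : ∀ (x y : A₁) (u : A₂),
      r2l (α₂ u) (br₁ x y) - br₁ (r2l u x) (α₁ y) + br₁ (r2l u y) (α₁ x)
        - r2l (r1r x u) (α₁ y) + r2l (r1r y u) (α₁ x) = 0)
    (mp6 : ∀ (x y : A₁) (u : A₂),
      r2r (α₂ u) (br₁ x y) - br₁ (r2r u x) (α₁ y) + br₁ (α₁ x) (r2l u y)
        - r2l (r1l x u) (α₁ y) + r2r (r1r y u) (α₁ x) = 0)
    -- mixed compatibility conditions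
    (mx1 : ∀ (x y : A₁) (u : A₂),
      l2l (α₂ u) (br₁ x y) + mul₁ (r2l u y) (α₁ x) + l2l (r1r y u) (α₁ x)
        - br₁ (l2l u x) (α₁ y) - r2l (l1r x u) (α₁ y) = 0)
    (mx2 : ∀ (x y : A₁) (u : A₂),
      l2r (α₂ u) (br₁ x y) + mul₁ (α₁ x) (r2l u y) + l2r (r1r y u) (α₁ x)
        - br₁ (l2r u x) (α₁ y) - r2l (l1l x u) (α₁ y) = 0)
    (mx3 : ∀ (x : A₁) (u v : A₂),
      l1l (α₁ x) (br₂ u v) + mul₂ (r1l x v) (α₂ u) + l1l (r2r v x) (α₂ u)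
        - br₂ (l1l x u) (α₂ v) - r1l (l2r u x) (α₂ v) = 0)
    (mx4 : ∀ (x : A₁) (u v : A₂),
      l1r (α₁ x) (br₂ u v) + mul₂ (α₂ u) (r1l x v) + l1r (r2r v x) (α₂ u)
        - br₂ (l1r x u) (α₂ v) - r1l (l2l u x) (α₂ v) = 0)
    (mx5 : ∀ (x y : A₁) (u : A₂),
      r2r (α₂ u) (mul₁ x y) - mul₁ (α₁ x) (r2r u y) - l2r (r1l y u) (α₁ x)
        - mul₁ (r2r u x) (α₁ y) - l2l (r1l x u) (α₁ y) = 0)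
    (mx6 : ∀ (x : A₁) (u v : A₂),
      r1r (α₁ x) (mul₂ u v) - mul₂ (α₂ u) (r1r x v) - l1r (r2l v x) (α₂ u)
        - mul₂ (r1r x u) (α₂ v) - l1l (r2l u x) (α₂ v) = 0)
    (Mul Br : (A₁ × A₂) →ₗ[K] (A₁ × A₂) →ₗ[K] (A₁ × A₂))
    (hMul : ∀ p q : A₁ × A₂,
      Mul p q = (mul₁ p.1 q.1 + l2l p.2 q.1 + l2r q.2 p.1,
                 mul₂ p.2 q.2 + l1l p.1 q.2 + l1r q.1 p.2))
    (hBr : ∀ p q : A₁ × A₂,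
      Br p q = (br₁ p.1 q.1 + r2l p.2 q.1 + r2r q.2 p.1,
                br₂ p.2 q.2 + r1l p.1 q.2 + r1r q.1 p.2)) :
    IsHomLeibnizPoisson Mul Br (α₁.prodMap α₂) := by
  obtain ⟨⟨mul_α₁, assoc₁⟩, ⟨br_α₁, leib₁⟩, poisson₁⟩ := h₁
  obtain ⟨⟨mul_α₂, assoc₂⟩, ⟨br_α₂, leib₂⟩, poisson₂⟩ := h₂
  obtain ⟨⟨l1l_α, l1r_α, l1l_mul, l1r_mul, l1_comm⟩,
    ⟨r1l_α, r1r_α, r1l_br, r1r_r1l, r1r_r1r⟩, r1r_l1l, r1r_l1r, r1l_mul⟩ := hrep₁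
  obtain ⟨⟨l2l_α, l2r_α, l2l_mul, l2r_mul, l2_comm⟩,
    ⟨r2l_α, r2r_α, r2l_br, r2r_r2l, r2r_r2r⟩, r2r_l2l, r2r_l2r, r2l_mul⟩ := hrep₂
  refine ⟨⟨?_, ?_⟩, ⟨?_, ?_⟩, ?_⟩
  · rintro ⟨x, u⟩ ⟨y, v⟩
    simp only [hMul, LinearMap.prodMap_apply, map_add, mul_α₁, mul_α₂, l1l_α, l1r_α, l2l_α, l2r_α]
  · rintro ⟨x, u⟩ ⟨y, v⟩ ⟨z, w⟩
    ext <;> simp only [hMul, LinearMap.prodMap_apply, map_add, LinearMap.add_apply]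
    · linear_combination (norm := module) assoc₁ x y z + ma4 x y w + ma6 x z v - ma3 y z u
        + l2l_mul u v z - l2r_mul v w x - l2_comm u w y
    · linear_combination (norm := module) assoc₂ u v w + ma2 z u v + ma5 y u w - ma1 x v w
        + l1l_mul x y w - l1r_mul y z u - l1_comm x z v
  · rintro ⟨x, u⟩ ⟨y, v⟩
    simp only [hBr, LinearMap.prodMap_apply, map_add, br_α₁, br_α₂, r1l_α, r1r_α, r2l_α, r2r_α]
  · rintro ⟨x, u⟩ ⟨y, v⟩ ⟨z, w⟩
    ext <;> simp only [hBr, LinearMap.prodMap_apply, map_add, LinearMap.add_apply, Prod.mk_add_mk]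
    · linear_combination (norm := module) leib₁ x y z + mp4 x y w - mp6 x z v - mp5 y z u
        + r2l_br u v z + r2r_r2l u w y + r2r_r2r v w x
    · linear_combination (norm := module) leib₂ u v w + mp1 z u v - mp3 y u w - mp2 x v w
        + r1l_br x y w + r1r_r1l x z v + r1r_r1r y z u
  · rintro ⟨x, u⟩ ⟨y, v⟩ ⟨z, w⟩
    ext <;> simp only [hMul, hBr, LinearMap.prodMap_apply, map_add, LinearMap.add_apply,
      Prod.mk_add_mk]
    · linear_combination (norm := module) poisson₁ x y z + mx5 x y w - mx2 x z v - mx1 y z u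
        + r2l_mul u v z + r2r_l2l u w y + r2r_l2r v w x
    · linear_combination (norm := module) poisson₂ u v w + mx6 z u v - mx4 y u w - mx3 x v w
        + r1l_mul x y w + r1r_l1l x z v + r1r_l1r y z u
end

section
/- Let (A,·,[,],α) be a Hom-Leibniz Poisson algebra, (V, λˡ, λʳ, ρˡ, ρʳ, φ) a representation of it, and T: V → A a linear map. Equip A ⊕ V with the semidirect product Hom-Leibniz Poisson structure (x,u)∗(y,v) := (x·y, λˡ(x)v + λʳ(y)u), {(x,u),(y,v)} := ([x,y], ρˡ(x)v + ρʳ(y)u), (α⊕φ)(x,u) := (α(x), φ(u)), and define T̂: A ⊕ V → A ⊕ V by T̂(a,v) := (T(v), 0). Then T is a relative Rota-Baxter operator on (A,·,[,],α) with respect to (V, λˡ, λʳ, ρˡ, ρʳ, φ) if and only if T̂ is a Rota-Baxter operator of weight 0 on A ⊕ V, i.e. T̂∘(α⊕φ) = (α⊕φ)∘T̂, T̂(w₁)∗T̂(w₂) = T̂(T̂(w₁)∗w₂ + w₁∗T̂(w₂)) and {T̂(w₁),T̂(w₂)} = T̂({T̂(w₁),w₂} + {w₁,T̂(w₂)}) for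 all w₁,w₂ ∈ A ⊕ V. -/
/-- `T : V → A` is a relative Rota-Baxter operator on a Hom-Leibniz Poisson algebra
`(A,·,[,],α)` with respect to a representation `(V, λˡ, λʳ, ρˡ, ρʳ, φ)` iff the lift
`T̂(a,v) := (T v, 0)` is a Rota-Baxter operator of weight `0` on the semidirect product
`A ⊕ V`. -/
theorem relativeRotaBaxter_iff_lift_rotaBaxter
    {K A V : Type*} [Field K] [CharZero K]
    [AddCommGroup A] [Module K A] [AddCommGroup V] [Module K V]
    (mul br : A →ₗ[K] A →ₗ[K] A) (α : A →ₗ[K] A)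
    (hA : IsHomLeibnizPoisson mul br α)
    (ll lr rl rr : A →ₗ[K] V →ₗ[K] V) (φ : V →ₗ[K] V)
    (hrep : IsLPRep mul br α ll lr rl rr φ)
    (Mul Br : (A × V) →ₗ[K] (A × V) →ₗ[K] (A × V))
    (hMul : ∀ p q : A × V, Mul p q = (mul p.1 q.1, ll p.1 q.2 + lr q.1 p.2))
    (hBr : ∀ p q : A × V, Br p q = (br p.1 q.1, rl p.1 q.2 + rr q.1 p.2))
    (T : V →ₗ[K] A) :
    ((∀ v, T (φ v) = α (T v)) ∧
     (∀ u v, mul (T u) (T v) = T (ll (T u) v + lr (T v) u)) ∧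
     (∀ u v, br (T u) (T v) = T (rl (T u) v + rr (T v) u))) ↔
    (let That : (A × V) →ₗ[K] (A × V) :=
        (LinearMap.inl K A V).comp (T.comp (LinearMap.snd K A V))
     (∀ p : A × V, That (α.prodMap φ p) = α.prodMap φ (That p)) ∧
     (∀ w₁ w₂ : A × V, Mul (That w₁) (That w₂) =
        That (Mul (That w₁) w₂ + Mul w₁ (That w₂))) ∧
     (∀ w₁ w₂ : A × V, Br (That w₁) (That w₂) =
        That (Br (That w₁) w₂ + Br w₁ (That w₂)))) := by
  constructor
  · rintro ⟨hφ, hmul, hbr⟩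
    refine ⟨fun p => ?_, fun w₁ w₂ => ?_, fun w₁ w₂ => ?_⟩
    · simp [hφ]
    · simp [hMul, hmul]
    · simp [hBr, hbr]
  · rintro ⟨hφ, hmul, hbr⟩
    refine ⟨fun v => ?_, fun u v => ?_, fun u v => ?_⟩
    · simpa using hφ (0, v)
    · simpa [hMul] using hmul (0, u) (0, v)
    · simpa [hBr] using hbr (0, u) (0, v)
end

section
/- Let (A,·,[,],α) be a Hom-Leibniz Poisson algebra, (V, λˡ, λʳ, ρˡ, ρʳ, φ) a representation of it, and T: V → A a linear map. Equip A ⊕ V with the semidirect product Hom-Leibniz Poisson structure (x,u)∗(y,v) := (x·y, λˡ(x)v + λʳ(y)u), {(x,u),(y,v)} := ([x,y], ρˡ(x)v + ρʳ(y)u), (α⊕φ)(x,u) := (α(x), φ(u)), and define N_T: A ⊕ V → A ⊕ V by N_T(a,v) := (T(v), 0). Then T is a relative Rota-Baxter operator on (A,·,[,],α) with respect to (V, λˡ, λʳ, ρˡ, ρʳ, φ) if and only if N_T is a Nijenhuis operator on the Hom-Leibniz Poisson algebra A ⊕ V. -/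
/-- `T : V → A` is a relative Rota-Baxter operator on a Hom-Leibniz Poisson algebra
`(A,·,[,],α)` with respect to a representation `(V, λˡ, λʳ, ρˡ, ρʳ, φ)` iff
`N_T(a,v) := (T v, 0)` is a Nijenhuis operator on the semidirect product `A ⊕ V`. -/
theorem relativeRotaBaxter_iff_nijenhuis
    {K A V : Type*} [Field K] [CharZero K]
    [AddCommGroup A] [Module K A] [AddCommGroup V] [Module K V]
    (mul br : A →ₗ[K] A →ₗ[K] A) (α : A →ₗ[K] A)
    (hA : IsHomLeibnizPoisson mul br α)
    (ll lr rl rr : A →ₗ[K] V →ₗ[K] V) (φ : V →ₗ[K] V)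
    (hrep : IsLPRep mul br α ll lr rl rr φ)
    (Mul Br : (A × V) →ₗ[K] (A × V) →ₗ[K] (A × V))
    (hMul : ∀ p q : A × V, Mul p q = (mul p.1 q.1, ll p.1 q.2 + lr q.1 p.2))
    (hBr : ∀ p q : A × V, Br p q = (br p.1 q.1, rl p.1 q.2 + rr q.1 p.2))
    (T : V →ₗ[K] A) :
    ((∀ v, T (φ v) = α (T v)) ∧
     (∀ u v, mul (T u) (T v) = T (ll (T u) v + lr (T v) u)) ∧
     (∀ u v, br (T u) (T v) = T (rl (T u) v + rr (T v) u))) ↔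
    (let N : (A × V) →ₗ[K] (A × V) :=
        (LinearMap.inl K A V).comp (T.comp (LinearMap.snd K A V))
     (∀ p : A × V, N (α.prodMap φ p) = α.prodMap φ (N p)) ∧
     (∀ p q : A × V, Mul (N p) (N q) = N (Mul (N p) q + Mul p (N q) - N (Mul p q))) ∧
     (∀ p q : A × V, Br (N p) (N q) = N (Br (N p) q + Br p (N q) - N (Br p q)))) := by
  simp only [LinearMap.comp_apply, LinearMap.inl_apply, LinearMap.snd_apply,
    LinearMap.prodMap_apply, hMul, hBr, Prod.forall, Prod.snd_add, Prod.snd_sub, Prod.mk.injEq,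
    map_zero, add_zero, zero_add, sub_zero, and_true]
  exact ⟨fun ⟨h₁, h₂, h₃⟩ => ⟨fun _ => h₁, fun _ u _ => h₂ u, fun _ u _ => h₃ u⟩,
    fun ⟨h₁, h₂, h₃⟩ => ⟨h₁ 0, fun u => h₂ 0 u 0, fun u => h₃ 0 u 0⟩⟩
end

section
/- Let T be a relative Rota-Baxter operator on a Hom-Leibniz Poisson algebra (A,·,[,],α) with respect to a representation (V, λˡ, λʳ, ρˡ, ρʳ, φ). Define on V the operations u⋄v := λˡ(T(u))v + λʳ(T(v))u and [u,v]_T := ρˡ(T(u))v + ρʳ(T(v))u. Then (V, ⋄, [,]_T, φ) is a Hom-Leibniz Poisson algebra. -/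
/-- If `T` is a relative Rota-Baxter operator on a Hom-Leibniz Poisson algebra
`(A,·,[,],α)` with respect to a representation `(V, λˡ, λʳ, ρˡ, ρʳ, φ)`, then
`u⋄v := λˡ(Tu)v + λʳ(Tv)u` and `[u,v]_T := ρˡ(Tu)v + ρʳ(Tv)u` make `(V, ⋄, [,]_T, φ)`
a Hom-Leibniz Poisson algebra. -/
theorem homLeibnizPoisson_of_relativeRotaBaxter
    {K A V : Type*} [Field K] [CharZero K]
    [AddCommGroup A] [Module K A] [AddCommGroup V] [Module K V]
    (mul br : A →ₗ[K] A →ₗ[K] A) (α : A →ₗ[K] A)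
    (hA : IsHomLeibnizPoisson mul br α)
    (ll lr rl rr : A →ₗ[K] V →ₗ[K] V) (φ : V →ₗ[K] V)
    (hrep : IsLPRep mul br α ll lr rl rr φ)
    (T : V →ₗ[K] A)
    (hTφ : ∀ v, T (φ v) = α (T v))
    (hTm : ∀ u v, mul (T u) (T v) = T (ll (T u) v + lr (T v) u))
    (hTb : ∀ u v, br (T u) (T v) = T (rl (T u) v + rr (T v) u)) :
    IsHomLeibnizPoisson (ll.comp T + (lr.comp T).flip) (rl.comp T + (rr.comp T).flip)
      φ := by
  obtain ⟨⟨hφll, hφlr, hll, hlr, hllr⟩, ⟨hφrl, hφrr, hrl, hrrl, hrr⟩, hrrll, hrrlr, hrlm⟩ := hrep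
  refine ⟨⟨fun u v => ?_, fun u v w => ?_⟩, ⟨fun u v => ?_, fun u v w => ?_⟩, fun u v w => ?_⟩ <;>
    simp only [LinearMap.add_apply, LinearMap.flip_apply, LinearMap.comp_apply, ← hTm, ← hTb, hTφ]
  · rw [map_add, hφll, hφlr]
  · rw [map_add, map_add, hll, hlr, hllr]
    abel
  · rw [map_add, hφrl, hφrr]
  · rw [map_add, map_add, map_add, hrl (T u) (T v), hrrl (T u) (T w), hrr (T v) (T w)]
    abel
  · rw [map_add, map_add, map_add, hrlm, hrrll, hrrlr]
    abel
end

section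
/- Let T be a relative Rota-Baxter operator on a Hom-Leibniz Poisson algebra (A,·,[,],α) with respect to a representation (V, λˡ, λʳ, ρˡ, ρʳ, φ), and equip V with the Hom-Leibniz Poisson structure u⋄v := λˡ(T(u))v + λʳ(T(v))u, [u,v]_T := ρˡ(T(u))v + ρʳ(T(v))u. Define λ̄ˡ, λ̄ʳ, ρ̄ˡ, ρ̄ʳ: V → End(A) by λ̄ˡ(u)x := T(u)·x − T(λʳ(x)u), λ̄ʳ(u)x := x·T(u) − T(λˡ(x)u), ρ̄ˡ(u)x := [T(u),x] − T(ρʳ(x)u), ρ̄ʳ(u)x := [x,T(u)] − T(ρˡ(x)u). Then (A, λ̄ˡ, λ̄ʳ, ρ̄ˡ, ρ̄ʳ, α) is a representation of the Hom-Leibniz Poisson algebra (V, ⋄, [,]_T, φ). -/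
/-- If `T` is a relative Rota-Baxter operator on a Hom-Leibniz Poisson algebra
`(A,·,[,],α)` with respect to a representation `(V, λˡ, λʳ, ρˡ, ρʳ, φ)`, then
`(A, λ̄ˡ, λ̄ʳ, ρ̄ˡ, ρ̄ʳ, α)` is a representation of the Hom-Leibniz Poisson algebra
`(V, ⋄, [,]_T, φ)`, where `λ̄ˡ(u)x = T(u)·x − T(λʳ(x)u)`, `λ̄ʳ(u)x = x·T(u) − T(λˡ(x)u)`,
`ρ̄ˡ(u)x = [Tu,x] − T(ρʳ(x)u)`, `ρ̄ʳ(u)x = [x,Tu] − T(ρˡ(x)u)`. -/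
theorem rep_of_relativeRotaBaxter_homLeibnizPoisson
    {K A V : Type*} [Field K] [CharZero K]
    [AddCommGroup A] [Module K A] [AddCommGroup V] [Module K V]
    (mul br : A →ₗ[K] A →ₗ[K] A) (α : A →ₗ[K] A)
    (hA : IsHomLeibnizPoisson mul br α)
    (ll lr rl rr : A →ₗ[K] V →ₗ[K] V) (φ : V →ₗ[K] V)
    (hrep : IsLPRep mul br α ll lr rl rr φ)
    (T : V →ₗ[K] A)
    (hTφ : ∀ v, T (φ v) = α (T v))
    (hTm : ∀ u v, mul (T u) (T v) = T (ll (T u) v + lr (T v) u))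
    (hTb : ∀ u v, br (T u) (T v) = T (rl (T u) v + rr (T v) u)) :
    IsLPRep (ll.comp T + (lr.comp T).flip) (rl.comp T + (rr.comp T).flip) φ
      (mul.comp T - lr.flip.compr₂ T) (mul.flip.comp T - ll.flip.compr₂ T)
      (br.comp T - rr.flip.compr₂ T) (br.flip.comp T - rl.flip.compr₂ T) α := by
  obtain ⟨⟨hα, hass⟩, ⟨hβ, hleib⟩, hpois⟩ := hA
  obtain ⟨⟨a1, a2, a3, a4, a5⟩, ⟨b1, b2, b3, b4, b5⟩, c1, c2, c3⟩ := hrep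
  have b3' : ∀ (x y : A) (v : V), rl (α x) (rl y v) = - rl (α x) (rr y v) := fun x y v => by
    have h := b3 x y v
    rw [b4 x y v, ← add_assoc, right_eq_add] at h
    exact eq_neg_of_add_eq_zero_left h
  have hleib' : ∀ x y z : A,
      br (α x) (br y z) = br (br x y) (α z) - br (br x z) (α y) := fun x y z => by
    rw [hleib, add_sub_cancel_right]
  have b4' : ∀ (x y : A) (v : V),
      rl (br x y) (φ v) = rr (α y) (rl x v) - rl (α x) (rr y v) := fun x y v => by
    rw [b4, add_sub_cancel_left]
  have b5' : ∀ (x y : A) (v : V),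
      rr (br x y) (φ v) = rr (α y) (rr x v) - rr (α x) (rr y v) := fun x y v => by
    rw [b5, add_sub_cancel_right]
  have c1' : ∀ (x y : A) (v : V),
      ll (br x y) (φ v) = rr (α y) (ll x v) - ll (α x) (rr y v) := fun x y v => by
    rw [c1, add_sub_cancel_left]
  have c2' : ∀ (x y : A) (v : V),
      lr (br x y) (φ v) = rr (α y) (lr x v) - lr (α x) (rr y v) := fun x y v => by
    rw [c2, add_sub_cancel_right]
  have m1 : ∀ u w, mul (α (T u)) (T w) = T (ll (α (T u)) w) + T (lr (T w) (φ u)) := fun u w => by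
    rw [← hTφ, hTm, map_add]
  have m2 : ∀ u w, mul (T w) (α (T u)) = T (ll (T w) (φ u)) + T (lr (α (T u)) w) := fun u w => by
    rw [← hTφ, hTm, map_add]
  have n1 : ∀ u w, br (α (T u)) (T w) = T (rl (α (T u)) w) + T (rr (T w) (φ u)) := fun u w => by
    rw [← hTφ, hTb, map_add]
  have n2 : ∀ u w, br (T w) (α (T u)) = T (rl (T w) (φ u)) + T (rr (α (T u)) w) := fun u w => by
    rw [← hTφ, hTb, map_add]
  refine ⟨⟨?_, ?_, ?_, ?_, ?_⟩, ⟨?_, ?_, ?_, ?_, ?_⟩, ?_, ?_, ?_⟩ <;> intros <;>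
    simp only [LinearMap.sub_apply, LinearMap.add_apply, LinearMap.comp_apply,
      LinearMap.flip_apply, LinearMap.compr₂_apply, ← hTm, ← hTb, hTφ, map_sub] <;>
    simp only [← hTφ, a1, a2, b1, b2, hα, hβ] <;>
    simp only [hTφ, hass, hleib', hpois, map_add, m1, m2, n1, n2] <;>
    simp only [a3, a4, a5, b3', b4', b5', c1', c2', c3, map_add, map_sub, map_neg] <;>
    abel
end
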